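/- Let d ≥ 3 and let S, T ⊆ {1,…,d} be such that there exists i ∈ S ∩ T with S \ {i} ≠ ∅ and T \ {i} ≠ ∅. Then the truncated function h' is 1/16-far from unate: every unate function g : {0,1}^d → ℝ satisfies |{x ∈ {0,1}^d : g(x) ≠ h'(x)}| ≥ 2^d / 16. -/

import Mathlib

open Finset
open scoped Classical

/-- Hamming weight of a point of the hypercube `{0,1}^d`. -/
def hammingWt {d : ℕ} (x : Fin d → Bool) : ℕ :=
  (univ.filter fun i => x i).card

/-- The character `χ_S(x) = (-1)^{Σ_{i∈S} x_i}`. -/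
def chi {d : ℕ} (S : Finset (Fin d)) (x : Fin d → Bool) : ℤ :=
  (-1) ^ (S.filter fun i => x i).card

/-- The function `h(x) = 2|x| + χ_S(x) + χ_T(x)`. -/
def hFun {d : ℕ} (S T : Finset (Fin d)) (x : Fin d → Bool) : ℤ :=
  2 * (hammingWt x : ℤ) + chi S x + chi T x

/-- The truncated function `h'`. -/
noncomputable def hFun' {d : ℕ} (S T : Finset (Fin d)) (x : Fin d → Bool) : ℝ :=
  if (hammingWt x : ℝ) < d / 2 - 3 * Real.sqrt d then d - 6 * Real.sqrt d - 2
  else if (hammingWt x : ℝ) > d / 2 + 3 * Real.sqrt d then d + 6 * Real.sqrt d + 2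
  else (hFun S T x : ℝ)

/-- A function on the hypercube is unate if there is an orientation of the
coordinates making it monotone with respect to that orientation. -/
def IsUnate {d : ℕ} {R : Type*} [Preorder R] (f : (Fin d → Bool) → R) : Prop :=
  ∃ σ : Fin d → Bool, ∀ (i : Fin d) (x : Fin d → Bool),
    if σ i then f (Function.update x i false) ≤ f (Function.update x i true)
    else f (Function.update x i true) ≤ f (Function.update x i false)

/-- The point `x` with its `j`-th coordinate negated. -/
def flipCoord {d : ℕ} (j : Fin d) (x : Fin d → Bool) : Fin d → Bool :=
  Function.update x j (!x j)

lemma flipCoord_flipCoord {d : ℕ} (j : Fin d) (x : Fin d → Bool) :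
    flipCoord j (flipCoord j x) = x := by
  simp [flipCoord]

lemma chi_eq_prod {d : ℕ} (S : Finset (Fin d)) (x : Fin d → Bool) :
    chi S x = ∏ j ∈ S, if x j then (-1 : ℤ) else 1 := by
  rw [← Finset.prod_filter, Finset.prod_const, chi]

lemma chi_flipCoord_of_notMem {d : ℕ} {S : Finset (Fin d)} {j : Fin d} (hj : j ∉ S)
    (x : Fin d → Bool) : chi S (flipCoord j x) = chi S x := by
  rw [chi_eq_prod, chi_eq_prod]
  refine Finset.prod_congr rfl fun k hk => ?_
  have hkj : k ≠ j := fun h => hj (h ▸ hk)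
  simp [flipCoord, Function.update_of_ne hkj]

lemma chi_flipCoord_of_mem {d : ℕ} {S : Finset (Fin d)} {j : Fin d} (hj : j ∈ S)
    (x : Fin d → Bool) : chi S (flipCoord j x) = -chi S x := by
  have h := chi_flipCoord_of_notMem (Finset.notMem_erase j S) x
  rw [chi_eq_prod, chi_eq_prod] at h
  rw [chi_eq_prod, chi_eq_prod, ← Finset.mul_prod_erase S _ hj, h,
    ← Finset.mul_prod_erase S (fun k => if x k then (-1 : ℤ) else 1) hj]
  cases hx : x j <;> simp [flipCoord, hx]

lemma chi_eq_one_or_neg_one {d : ℕ} (S : Finset (Fin d)) (x : Fin d → Bool) :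
    chi S x = 1 ∨ chi S x = -1 :=
  neg_one_pow_eq_or ℤ _

lemma chi_singleton {d : ℕ} (j : Fin d) (x : Fin d → Bool) :
    chi {j} x = if x j then -1 else 1 := by
  rw [chi_eq_prod, Finset.prod_singleton]

lemma sum_eq_zero_of_flipCoord_eq_neg {d : ℕ} (j : Fin d) (F : (Fin d → Bool) → ℤ)
    (hF : ∀ x, F (flipCoord j x) = -F x) : ∑ x, F x = 0 := by
  have h : ∑ x, F (flipCoord j x) = ∑ x, F x :=
    Equiv.sum_comp (Function.Involutive.toPerm (flipCoord j) (flipCoord_flipCoord j)) F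
  simp only [hF, Finset.sum_neg_distrib] at h
  omega

lemma sum_chi_eq_zero {d : ℕ} {S : Finset (Fin d)} (hS : S.Nonempty) :
    ∑ x, chi S x = 0 := by
  obtain ⟨j, hj⟩ := hS
  exact sum_eq_zero_of_flipCoord_eq_neg j _ fun x => chi_flipCoord_of_mem hj x

lemma sum_chi_mul_chi_eq_zero {d : ℕ} {S T : Finset (Fin d)} (hST : S ≠ T) :
    ∑ x, chi S x * chi T x = 0 := by
  obtain ⟨j, hj⟩ : ∃ j, ¬(j ∈ S ↔ j ∈ T) := by
    by_contra! h
    exact hST (Finset.ext h)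
  refine sum_eq_zero_of_flipCoord_eq_neg j _ fun x => ?_
  by_cases h : j ∈ S
  · have h' : j ∉ T := fun h' => hj ⟨fun _ => h', fun _ => h⟩
    rw [chi_flipCoord_of_mem h, chi_flipCoord_of_notMem h', neg_mul]
  · have h' : j ∈ T := by
      by_contra h'
      exact hj ⟨fun a => absurd a h, fun a => absurd a h'⟩
    rw [chi_flipCoord_of_mem h', chi_flipCoord_of_notMem h, mul_neg]

lemma chi_mul_self {d : ℕ} (S : Finset (Fin d)) (x : Fin d → Bool) :
    chi S x * chi S x = 1 := by
  rcases chi_eq_one_or_neg_one S x with h | h <;> simp [h]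

lemma sum_chi_mul_self {d : ℕ} (S : Finset (Fin d)) :
    ∑ x, chi S x * chi S x = 2 ^ d := by
  simp [chi_mul_self]

lemma two_mul_hammingWt_sub {d : ℕ} (x : Fin d → Bool) :
    2 * (hammingWt x : ℤ) - d = -∑ j, chi {j} x := by
  have h : ∀ j, chi {j} x = 1 - 2 * (if x j then 1 else 0) := fun j => by
    rw [chi_singleton]
    split_ifs <;> norm_num
  simp only [h, Finset.sum_sub_distrib, ← Finset.mul_sum, hammingWt, Finset.card_filter]
  simp

lemma sum_sq_two_mul_hammingWt_sub (d : ℕ) :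
    ∑ x : Fin d → Bool, (2 * (hammingWt x : ℤ) - d) ^ 2 = (d : ℤ) * 2 ^ d := by
  simp only [two_mul_hammingWt_sub, sq, neg_mul_neg, Finset.sum_mul_sum]
  rw [Finset.sum_comm]
  have h : ∀ j : Fin d,
      ∑ x : Fin d → Bool, ∑ k, chi {j} x * chi {k} x = (2 : ℤ) ^ d := fun j => by
    rw [Finset.sum_comm, Finset.sum_eq_single j]
    · exact sum_chi_mul_self _
    · intro k _ hk
      exact sum_chi_mul_chi_eq_zero fun h => hk (Finset.singleton_injective h).symm
    · simp
  simp [h]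

/-- The points at which `hFun'` is truncated. -/
noncomputable def truncatedPoints (d : ℕ) : Finset (Fin d → Bool) :=
  univ.filter fun x => (hammingWt x : ℝ) < d / 2 - 3 * Real.sqrt d ∨
    (hammingWt x : ℝ) > d / 2 + 3 * Real.sqrt d

lemma card_truncatedPoints_le {d : ℕ} (hd : 0 < d) :
    36 * ((truncatedPoints d).card : ℝ) ≤ 2 ^ d := by
  have hd' : (0 : ℝ) < d := by exact_mod_cast hd
  have hsum : ∑ x : Fin d → Bool, (2 * (hammingWt x : ℝ) - d) ^ 2 = (d : ℝ) * 2 ^ d := by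
    exact_mod_cast sum_sq_two_mul_hammingWt_sub d
  have hpt : ∀ x ∈ truncatedPoints d, 36 * (d : ℝ) ≤ (2 * (hammingWt x : ℝ) - d) ^ 2 := by
    intro x hx
    have hs := Real.sq_sqrt hd'.le
    have hs0 := Real.sqrt_nonneg (d : ℝ)
    rcases (Finset.mem_filter.mp hx).2 with h | h <;> nlinarith
  have h1 := Finset.card_nsmul_le_sum _ _ _ hpt
  have h2 : ∑ x ∈ truncatedPoints d, (2 * (hammingWt x : ℝ) - d) ^ 2 ≤
      ∑ x : Fin d → Bool, (2 * (hammingWt x : ℝ) - d) ^ 2 :=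
    Finset.sum_le_sum_of_subset_of_nonneg (Finset.subset_univ _) fun _ _ _ => sq_nonneg _
  rw [nsmul_eq_mul] at h1
  refine le_of_mul_le_mul_left ?_ hd'
  linarith

lemma hFun'_of_notMem_truncatedPoints {d : ℕ} (S T : Finset (Fin d)) {x : Fin d → Bool}
    (hx : x ∉ truncatedPoints d) : hFun' S T x = hFun S T x := by
  simp only [truncatedPoints, Finset.mem_filter, Finset.mem_univ, true_and, not_or] at hx
  rw [hFun', if_neg hx.1, if_neg hx.2]

/-- The points `x` with `x i = 0` at which both characters take the value `s`. -/
noncomputable def lowerPoints {d : ℕ} (S T : Finset (Fin d)) (i : Fin d) (s : ℤ) :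
    Finset (Fin d → Bool) :=
  univ.filter fun x => x i = false ∧ chi S x = s ∧ chi T x = s

lemma two_pow_le_card_lowerPoints {d : ℕ} {S T : Finset (Fin d)} {i : Fin d}
    (hiS : i ∈ S) (hiT : i ∈ T) (hS : (S.erase i).Nonempty) (hT : (T.erase i).Nonempty)
    {s : ℤ} (hs : s = 1 ∨ s = -1) :
    (2 : ℤ) ^ d ≤ 8 * (lowerPoints S T i s).card := by
  have hcard : 8 * ((lowerPoints S T i s).card : ℤ) =
      ∑ x, (1 + chi {i} x) * (1 + s * chi S x) * (1 + s * chi T x) := by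
    rw [lowerPoints, Finset.card_filter]
    push_cast
    rw [Finset.mul_sum]
    refine Finset.sum_congr rfl fun x _ => ?_
    rw [chi_singleton]
    rcases hs with rfl | rfl <;> rcases chi_eq_one_or_neg_one S x with h | h <;>
      rcases chi_eq_one_or_neg_one T x with h' | h' <;> cases hx : x i <;> simp [h, h']
  have hss : s * s = 1 := by rcases hs with rfl | rfl <;> norm_num
  have hexp : ∑ x, (1 + chi {i} x) * (1 + s * chi S x) * (1 + s * chi T x) =
      2 ^ d + ∑ x, chi {i} x + s * ∑ x, chi S x + s * ∑ x, chi T x +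
      s * ∑ x, chi {i} x * chi S x + s * ∑ x, chi {i} x * chi T x +
      ∑ x, chi S x * chi T x + ∑ x, chi {i} x * (chi S x * chi T x) := by
    have h1 : (2 : ℤ) ^ d = ∑ _x : Fin d → Bool, (1 : ℤ) := by simp
    rw [h1]
    simp only [Finset.mul_sum, ← Finset.sum_add_distrib]
    refine Finset.sum_congr rfl fun x _ => ?_
    linear_combination (chi S x * chi T x + chi {i} x * chi S x * chi T x) * hss
  have hne : ∀ {U : Finset (Fin d)}, (U.erase i).Nonempty → {i} ≠ U := by
    rintro U hU rfl
    simp at hU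
  have htriple : ∑ x, chi {i} x * (chi S x * chi T x) = 0 := by
    refine sum_eq_zero_of_flipCoord_eq_neg i _ fun x => ?_
    rw [chi_flipCoord_of_mem hiS, chi_flipCoord_of_mem hiT,
      chi_flipCoord_of_mem (Finset.mem_singleton_self i)]
    ring
  have hST : 0 ≤ ∑ x, chi S x * chi T x := by
    by_cases h : S = T
    · rw [h, sum_chi_mul_self]
      positivity
    · exact (sum_chi_mul_chi_eq_zero h).ge
  rw [hcard, hexp, sum_chi_eq_zero (Finset.singleton_nonempty i), sum_chi_eq_zero ⟨i, hiS⟩,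
    sum_chi_eq_zero ⟨i, hiT⟩, sum_chi_mul_chi_eq_zero (hne hS),
    sum_chi_mul_chi_eq_zero (hne hT), htriple]
  linarith

lemma hammingWt_update_true {d : ℕ} {x : Fin d → Bool} {i : Fin d} (hx : x i = false) :
    hammingWt (Function.update x i true) = hammingWt x + 1 := by
  have h : (univ.filter fun j => Function.update x i true j = true) =
      insert i (univ.filter fun j => x j = true) := by
    ext j
    by_cases hj : j = i
    · subst hj
      simp
    · simp [hj]
  rw [hammingWt, h, Finset.card_insert_of_notMem (by simp [hx]), hammingWt]

lemma hFun_update_true {d : ℕ} {S T : Finset (Fin d)} {x : Fin d → Bool} {i : Fin d}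
    (hiS : i ∈ S) (hiT : i ∈ T) (hx : x i = false) :
    hFun S T (Function.update x i true) = hFun S T x + 2 - 2 * chi S x - 2 * chi T x := by
  have h : Function.update x i true = flipCoord i x := by simp [flipCoord, hx]
  rw [hFun, hammingWt_update_true hx, h, chi_flipCoord_of_mem hiS, chi_flipCoord_of_mem hiT, hFun]
  push_cast
  ring

theorem stmt_6 (d : ℕ) (hd : 3 ≤ d) (S T : Finset (Fin d)) (i : Fin d)
    (hiS : i ∈ S) (hiT : i ∈ T)
    (hS : (S.erase i).Nonempty) (hT : (T.erase i).Nonempty)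
    (g : (Fin d → Bool) → ℝ) (hg : IsUnate g) :
    (2 : ℝ) ^ d / 16 ≤
      ((univ.filter fun x : Fin d → Bool => g x ≠ hFun' S T x).card : ℝ) := by
  obtain ⟨σ, hσ⟩ := hg
  set N := univ.filter fun x : Fin d → Bool => g x ≠ hFun' S T x with hN
  obtain ⟨s, hs, hsσ⟩ : ∃ s : ℤ, (s = 1 ∨ s = -1) ∧ s = if σ i then 1 else -1 :=
    ⟨if σ i then 1 else -1, by split_ifs <;> simp, rfl⟩
  have hsub : lowerPoints S T i s ⊆
      (N ∪ truncatedPoints d).image fun y => Function.update y i false := by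
    intro x hx
    obtain ⟨hxi, hxS, hxT⟩ := (Finset.mem_filter.mp hx).2
    have hx0 : Function.update x i false = x := by rw [← hxi, Function.update_eq_self]
    rw [Finset.mem_image]
    by_contra! hcon
    have h0 : x ∉ N ∪ truncatedPoints d := fun h => hcon x h hx0
    have h1 : Function.update x i true ∉ N ∪ truncatedPoints d := fun h =>
      hcon _ h (by rw [Function.update_idem, hx0])
    rw [Finset.mem_union, not_or] at h0 h1
    have e0 : g x = hFun S T x := by
      rw [← hFun'_of_notMem_truncatedPoints S T h0.2]
      simpa [hN] using h0.1
    have e1 : g (Function.update x i true) = hFun S T (Function.update x i true) := by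
      rw [← hFun'_of_notMem_truncatedPoints S T h1.2]
      simpa [hN] using h1.1
    have hi := hσ i x
    rw [hx0, e0, e1, hFun_update_true hiS hiT hxi, hxS, hxT, hsσ] at hi
    split_ifs at hi <;> norm_cast at hi <;> omega
  have hcard : (lowerPoints S T i s).card ≤ N.card + (truncatedPoints d).card :=
    (Finset.card_le_card hsub).trans (Finset.card_image_le.trans (Finset.card_union_le _ _))
  have hcard' : ((lowerPoints S T i s).card : ℝ) ≤ N.card + (truncatedPoints d).card := by
    exact_mod_cast hcard
  have hlow : (2 : ℝ) ^ d ≤ 8 * (lowerPoints S T i s).card := by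
    exact_mod_cast two_pow_le_card_lowerPoints hiS hiT hS hT hs
  have htr := card_truncatedPoints_le (d := d) (by omega)
  have hpos : (0 : ℝ) < 2 ^ d := by positivity
  linarith
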